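/- arXiv:1911.01588 — 2 statements merged into one kernel-verified Lean document; each statement's English description precedes it below -/
import Mathlib

section
/- Let n ≥ 1, let f : (Fin n → Bool) → Bool be a feedback function with Fibonacci transition map F_f, and let P : (Fin n → Bool) ≃ (Fin n → Bool) be a bijection preserving the output bit, (P x) ⟨0⟩ = x ⟨0⟩ for all x. If P commutes with F_f (P ∘ F_f = F_f ∘ P), then P is the identity. (The centralizer of a Fibonacci transition map among output-bit-preserving permutations is trivial.) -/
/-- The Fibonacci transition map `F_f` of an `n`-stage FSR with feedback function `f`:
`(F_f x) i = x (i+1)` when `(i : ℕ) + 1 < n`, and `(F_f x) i = f x` when `(i : ℕ) + 1 = n`. -/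
def fibStep (n : ℕ) (f : (Fin n → Bool) → Bool) (x : Fin n → Bool) : Fin n → Bool :=
  fun i => if h : (i : ℕ) + 1 < n then x ⟨(i : ℕ) + 1, h⟩ else f x

/-- The output sequence of the `n`-stage Fibonacci FSR with feedback `f` from initial state `x₀`. -/
def outF (n : ℕ) (hn : 0 < n) (f : (Fin n → Bool) → Bool) (x₀ : Fin n → Bool) (t : ℕ) : Bool :=
  (fibStep n f)^[t] x₀ ⟨0, hn⟩

/-- The output sequence of an `n`-stage (Galois) FSR with transition map `G` from initial state `z₀`. -/
def outG (n : ℕ) (hn : 0 < n) (G : (Fin n → Bool) → (Fin n → Bool)) (z₀ : Fin n → Bool) (t : ℕ) : Bool :=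
  (G^[t] z₀) ⟨0, hn⟩

theorem outF_eq_apply (n : ℕ) (hn : 0 < n) (f : (Fin n → Bool) → Bool) (x : Fin n → Bool)
    (i : Fin n) : outF n hn f x i = x i := by
  obtain ⟨t, ht⟩ := i
  induction t generalizing x with
  | zero => rfl
  | succ t ih =>
    have h := ih (fibStep n f x) (by omega)
    simpa [outF, fibStep, ht] using h

/-- The centralizer of a Fibonacci transition map among output-bit-preserving permutations
of the state space is trivial. -/
theorem fibonacci_centralizer_trivial (n : ℕ) (hn : 1 ≤ n)
    (f : (Fin n → Bool) → Bool)
    (P : (Fin n → Bool) ≃ (Fin n → Bool))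
    (hP : ∀ x : Fin n → Bool, P x ⟨0, hn⟩ = x ⟨0, hn⟩)
    (hcomm : ⇑P ∘ fibStep n f = fibStep n f ∘ ⇑P) :
    P = Equiv.refl (Fin n → Bool) := by
  have hit (t : ℕ) (x : Fin n → Bool) :
      P ((fibStep n f)^[t] x) = (fibStep n f)^[t] (P x) :=
    (Function.Semiconj.iterate_right (fun y => congrFun hcomm y) t) x
  ext x i
  rw [Equiv.refl_apply, ← outF_eq_apply n hn f (P x) i, ← outF_eq_apply n hn f x i,
    outF, outF, ← hit, hP]
end

section
/- (Remark 2 of the paper.) Let n ≥ 1 and let f : (Fin n → Bool) → Bool be a feedback function with Fibonacci transition map F_f. Then the number of transition maps G : (Fin n → Bool) → (Fin n → Bool) with G ≠ F_f whose set of output sequences equals that of the Fibonacci FSR, i.e. Nat.card {G // G ≠ F_f ∧ Set.range (outG G) = Set.range (outF f)}, is exactly ((2^(n-1))!)^2 − 1. In other words, a given n-stage Fibonacci FSR has a total of ((2^(n-1))!)^2 − 1 equivalent Galois FSRs with n stages. -/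
theorem fibStep_iterate_apply {n : ℕ} (f : (Fin n → Bool) → Bool) (x : Fin n → Bool) (t : ℕ)
    (i : Fin n) (h : (i : ℕ) + t < n) : (fibStep n f)^[t] x i = x ⟨i + t, h⟩ := by
  induction t generalizing i with
  | zero => rfl
  | succ t ih =>
    have hi : (i : ℕ) + 1 < n := by omega
    rw [Function.iterate_succ_apply', fibStep, dif_pos hi, ih ⟨i + 1, hi⟩ (by simp only; omega)]
    congr 2
    simp only
    omega

theorem outF_injective {n : ℕ} (hn : 0 < n) (f : (Fin n → Bool) → Bool) :
    Function.Injective (outF n hn f) := by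
  intro x y h
  funext i
  have hi := congrFun h i
  simpa [outF, fibStep_iterate_apply] using hi

theorem outG_map {n : ℕ} (hn : 0 < n) (G : (Fin n → Bool) → (Fin n → Bool)) (z : Fin n → Bool)
    (t : ℕ) : outG n hn G (G z) t = outG n hn G z (t + 1) := rfl

theorem outF_fibStep {n : ℕ} (hn : 0 < n) (f : (Fin n → Bool) → Bool) (x : Fin n → Bool) (t : ℕ) :
    outF n hn f (fibStep n f x) t = outF n hn f x (t + 1) := rfl

/-- Conjugating the Fibonacci map by a permutation that preserves the output bit relabels the
initial states. -/
theorem outG_conj {n : ℕ} (hn : 0 < n) (f : (Fin n → Bool) → Bool)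
    (φ : Equiv.Perm (Fin n → Bool)) (hφ : ∀ z, φ z ⟨0, hn⟩ = z ⟨0, hn⟩) (z : Fin n → Bool) :
    outG n hn (fun y => φ.symm (fibStep n f (φ y))) z = outF n hn f (φ z) := by
  funext t
  have hsemi : Function.Semiconj φ (fun y => φ.symm (fibStep n f (φ y))) (fibStep n f) :=
    fun y => φ.apply_symm_apply _
  rw [outG, outF, ← hsemi.iterate_right t z, hφ]

/-- A transition map with the same output sequences as a Fibonacci FSR is conjugate to it by a
permutation that preserves the output bit. -/
theorem exists_perm_of_range_eq {n : ℕ} (hn : 0 < n) (f : (Fin n → Bool) → Bool)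
    (G : (Fin n → Bool) → (Fin n → Bool))
    (h : Set.range (outG n hn G) = Set.range (outF n hn f)) :
    ∃ φ : Equiv.Perm (Fin n → Bool), (∀ z, φ z ⟨0, hn⟩ = z ⟨0, hn⟩) ∧
      (fun y => φ.symm (fibStep n f (φ y))) = G := by
  have hex : ∀ z, ∃ x, outF n hn f x = outG n hn G z := fun z => by
    have : outG n hn G z ∈ Set.range (outF n hn f) := h ▸ Set.mem_range_self z
    exact this
  choose φ hφ using hex
  have hsurj : Function.Surjective φ := by
    intro x
    obtain ⟨z, hz⟩ : outF n hn f x ∈ Set.range (outG n hn G) := h ▸ Set.mem_range_self x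
    exact ⟨z, outF_injective hn f ((hφ z).trans hz)⟩
  refine ⟨Equiv.ofBijective φ (Finite.injective_iff_bijective.mp
    (Finite.injective_iff_surjective.mpr hsurj)), fun z => congrFun (hφ z) 0, ?_⟩
  funext y
  rw [Equiv.symm_apply_eq]
  refine outF_injective hn f (funext fun t => ?_)
  simp only [Equiv.ofBijective_apply]
  rw [outF_fibStep, hφ, hφ, outG_map]

/-- Bit-preserving permutations of the states correspond to the transition maps with the same
output sequences as the Fibonacci FSR. -/
noncomputable def permEquivEquivalentGalois {n : ℕ} (hn : 0 < n) (f : (Fin n → Bool) → Bool) :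
    {φ : Equiv.Perm (Fin n → Bool) //
      (fun z : Fin n → Bool => z ⟨0, hn⟩) ∘ φ = fun z => z ⟨0, hn⟩} ≃
    {G : (Fin n → Bool) → (Fin n → Bool) //
      Set.range (outG n hn G) = Set.range (outF n hn f)} :=
  Equiv.ofBijective
    (fun φ => ⟨fun y => φ.1.symm (fibStep n f (φ.1 y)), by
      rw [funext (outG_conj hn f φ.1 (congrFun φ.2))]
      exact φ.1.surjective.range_comp (outF n hn f)⟩)
    ⟨fun φ ψ h => by
      have hG := congrArg Subtype.val h
      refine Subtype.ext (Equiv.ext fun z => outF_injective hn f ?_)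
      rw [← outG_conj hn f φ.1 (congrFun φ.2), ← outG_conj hn f ψ.1 (congrFun ψ.2)]
      exact congrArg (fun G => outG n hn G z) hG,
    fun ⟨G, hG⟩ => by
      obtain ⟨φ, hφ, hφG⟩ := exists_perm_of_range_eq hn f G hG
      exact ⟨⟨φ, funext hφ⟩, Subtype.ext hφG⟩⟩

theorem card_state_with_first_bit {n : ℕ} (hn : 0 < n) (b : Bool) :
    Fintype.card {z : Fin n → Bool // z ⟨0, hn⟩ = b} = 2 ^ (n - 1) := by
  obtain ⟨m, rfl⟩ := Nat.exists_eq_succ_of_ne_zero hn.ne'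
  let e : {z : Fin (m + 1) → Bool // z ⟨0, hn⟩ = b} ≃ (Fin m → Bool) :=
    { toFun := fun z => Fin.tail z.1
      invFun := fun y => ⟨Fin.cons b y, rfl⟩
      left_inv := by
        rintro ⟨z, rfl⟩
        exact Subtype.ext (Fin.cons_self_tail z)
      right_inv := fun y => Fin.tail_cons (α := fun _ => Bool) b y }
  simpa using Fintype.card_congr e

theorem card_range_outG_eq {n : ℕ} (hn : 0 < n) (f : (Fin n → Bool) → Bool) :
    Nat.card {G : (Fin n → Bool) → (Fin n → Bool) //
      Set.range (outG n hn G) = Set.range (outF n hn f)} = (Nat.factorial (2 ^ (n - 1))) ^ 2 := by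
  rw [← Nat.card_congr (permEquivEquivalentGalois hn f), Nat.card_eq_fintype_card,
    DomMulAct.stabilizer_card]
  simp only [card_state_with_first_bit hn, Fintype.univ_bool, Finset.prod_const]
  rfl

/-- Remark 2: a given `n`-stage Fibonacci FSR has exactly `((2^(n-1))!)^2 - 1` equivalent
`n`-stage Galois FSRs (transition maps different from `F_f` with the same set of output
sequences). -/
theorem card_equivalent_galois (n : ℕ) (hn : 1 ≤ n) (f : (Fin n → Bool) → Bool) :
    Nat.card {G : (Fin n → Bool) → (Fin n → Bool) //
        G ≠ fibStep n f ∧ Set.range (outG n hn G) = Set.range (outF n hn f)} =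
      (Nat.factorial (2 ^ (n - 1))) ^ 2 - 1 := by
  rw [← card_range_outG_eq hn f]
  have hmem : fibStep n f ∈ {G | Set.range (outG n hn G) = Set.range (outF n hn f)} := rfl
  refine Eq.trans (Nat.card_congr (Equiv.subtypeEquivRight fun G => and_comm)) ?_
  exact Set.ncard_sdiff_singleton_of_mem hmem
end
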